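/- Let d ≥ 1 be an integer, α ∈ (0,2), r_1 ∈ (0, 1/2] and p ∈ (α/2, α). Then there exist δ ∈ (0, r_1/4] and constants C ≥ c > 0, depending only on α, p, d and r_1, such that for every y ∈ V_δ the principal value limit defining Δ^{α/2} h_p(y) exists and c · (y_d − √(r_1² − |ỹ|²))^{p−α} ≤ Δ^{α/2} h_p(y) ≤ C · (y_d − √(r_1² − |ỹ|²))^{p−α}. -/

import Mathlib

open MeasureTheory Filter Set

/-- The constant 𝒜(d, -α) = α 2^{α-1} π^{-d/2} Γ((d+α)/2) Γ(1-α/2)^{-1}. -/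
noncomputable def fracConst (d : ℕ) (α : ℝ) : ℝ :=
  α * 2 ^ (α - 1) * Real.pi ^ (-(d : ℝ) / 2) *
    Real.Gamma (((d : ℝ) + α) / 2) / Real.Gamma (1 - α / 2)

/-- The Euclidean norm on ℝ^{m} × ℝ ≅ ℝ^{m+1}, writing y = (ỹ, y_d). -/
noncomputable def enorm' {m : ℕ} (y : EuclideanSpace ℝ (Fin m) × ℝ) : ℝ :=
  Real.sqrt (‖y.1‖ ^ 2 + y.2 ^ 2)

/-- The truncated-at-ε integral ∫_{|y-x|>ε} (u(y)-u(x)) |x-y|^{-d-α} dy on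
ℝ^{d-1} × ℝ ≅ ℝ^d, whose limit as ε ↓ 0 is the principal value integral defining the
fractional Laplacian Δ^{α/2}u(x) (up to the constant `fracConst d α`). -/
noncomputable def pvInt2 (d : ℕ) (α : ℝ)
    (u : EuclideanSpace ℝ (Fin (d - 1)) × ℝ → ℝ)
    (x : EuclideanSpace ℝ (Fin (d - 1)) × ℝ) (ε : ℝ) : ℝ :=
  ∫ y in {y : EuclideanSpace ℝ (Fin (d - 1)) × ℝ | ε < enorm' (y - x)},
    (u y - u x) / enorm' (x - y) ^ ((d : ℝ) + α)

/-- h_p(y) = (y_d - √(r₁² - |ỹ|²))^p on {r₁ < |y| < 3r₁/2, y_d > 0, |ỹ| < r₁/2},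
and 0 otherwise. -/
noncomputable def hfun (d : ℕ) (r1 p : ℝ)
    (y : EuclideanSpace ℝ (Fin (d - 1)) × ℝ) : ℝ :=
  if r1 < enorm' y ∧ enorm' y < 3 * r1 / 2 ∧ 0 < y.2 ∧ ‖y.1‖ < r1 / 2 then
    (y.2 - Real.sqrt (r1 ^ 2 - ‖y.1‖ ^ 2)) ^ p
  else 0

open scoped Topology
/-- The kernels `(1 - t)^s t^{-1-2s}` and `(1 - t)^{s-1} t^{-1-2s}` on `(ε, 1)` are integrable and
their integrals add up to an explicit quantity. -/
theorem unit_kernels_integral {s ε : ℝ} (hs : 0 < s) (hε : 0 < ε) (hε1 : ε < 1) :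
    IntegrableOn (fun t : ℝ => (1 - t) ^ (s - 1) * t ^ (-(1 + 2 * s))) (Ioo ε 1) ∧
    IntegrableOn (fun t : ℝ => (1 - t) ^ s * t ^ (-(1 + 2 * s))) (Ioo ε 1) ∧
    (∫ t in Ioo ε 1, (1 - t) ^ (s - 1) * t ^ (-(1 + 2 * s))) +
      (∫ t in Ioo ε 1, (1 - t) ^ s * t ^ (-(1 + 2 * s))) =
      (1 / s) * ((1 - ε) ^ s * ε ^ (-(2 * s))) := by
  set f : ℝ → ℝ := fun t => (1 - t) ^ (s - 1) * t ^ (-(1 + 2 * s)) with hf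
  set g : ℝ → ℝ := fun t => (1 - t) ^ s * t ^ (-(1 + 2 * s)) with hg
  set F : ℝ → ℝ := fun t => -(1 / s) * ((1 - t) ^ s * t ^ (-(2 * s))) with hF
  have hcont : ContinuousOn F (Icc ε 1) := by
    refine ContinuousOn.mul continuousOn_const (ContinuousOn.mul ?_ ?_)
    · exact ContinuousOn.rpow_const (by fun_prop) fun x _ => Or.inr hs.le
    · exact ContinuousOn.rpow_const (by fun_prop) fun x hx => Or.inl (by linarith [hx.1])
  have hder : ∀ t ∈ Ioo ε 1, HasDerivAt F (f t + g t) t := by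
    intro t ht
    have ht0 : 0 < t := hε.trans ht.1
    have ht1 : 0 < 1 - t := by linarith [ht.2]
    have h1 : HasDerivAt (fun t : ℝ => (1 - t) ^ s) (-1 * s * (1 - t) ^ (s - 1)) t :=
      ((hasDerivAt_id t).const_sub 1).rpow_const (Or.inl ht1.ne')
    have h2 : HasDerivAt (fun t : ℝ => t ^ (-(2 * s))) (1 * (-(2 * s)) * t ^ (-(2 * s) - 1)) t :=
      (hasDerivAt_id t).rpow_const (Or.inl ht0.ne')
    refine ((h1.mul h2).const_mul (-(1 / s))).congr_deriv ?_
    have e1 : (1 - t) ^ s = (1 - t) ^ (s - 1) * (1 - t) := by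
      rw [← Real.rpow_add_one ht1.ne']; congr 1; ring
    have e2 : t ^ (-(2 * s)) = t ^ (-(1 + 2 * s)) * t := by
      rw [← Real.rpow_add_one ht0.ne']; congr 1; ring
    have e3 : t ^ (-(2 * s) - 1) = t ^ (-(1 + 2 * s)) := by congr 1; ring
    simp only [hf, hg]
    rw [e3, e2, e1]
    field_simp
    ring
  have hpos : ∀ t ∈ Ioo ε 1, 0 ≤ f t ∧ 0 ≤ g t := by
    intro t ht
    have ht0 : 0 < t := hε.trans ht.1
    have ht1 : 0 < 1 - t := by linarith [ht.2]
    exact ⟨by positivity, by positivity⟩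
  have hint : IntegrableOn (fun t => f t + g t) (Ioc ε 1) :=
    intervalIntegral.integrableOn_deriv_of_nonneg hcont hder
      fun t ht => add_nonneg (hpos t ht).1 (hpos t ht).2
  have hint' : IntegrableOn (fun t => f t + g t) (Ioo ε 1) := hint.mono_set Ioo_subset_Ioc_self
  have hfi : IntegrableOn f (Ioo ε 1) := by
    refine Integrable.mono' hint' (by fun_prop) ?_
    filter_upwards [ae_restrict_mem measurableSet_Ioo] with t ht
    rw [Real.norm_of_nonneg (hpos t ht).1]
    linarith [(hpos t ht).2]
  have hgi : IntegrableOn g (Ioo ε 1) := by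
    refine Integrable.mono' hint' (by fun_prop) ?_
    filter_upwards [ae_restrict_mem measurableSet_Ioo] with t ht
    rw [Real.norm_of_nonneg (hpos t ht).2]
    linarith [(hpos t ht).1]
  refine ⟨hfi, hgi, ?_⟩
  have hFTC := intervalIntegral.integral_eq_sub_of_hasDerivAt_of_le hε1.le hcont hder
    ((intervalIntegrable_iff_integrableOn_Ioc_of_le hε1.le).2 hint)
  rw [intervalIntegral.integral_of_le hε1.le, integral_Ioc_eq_integral_Ioo,
    integral_add hfi hgi] at hFTC
  rw [hFTC]
  simp only [hF, sub_self, Real.zero_rpow hs.ne']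
  ring

/-- The substitution `t = τ / (1 - τ)` in the tail integral of `(1 + t)^s t^{-1-2s}`. -/
theorem tail_kernel_integral {s ε : ℝ} (hs : 0 < s) (hε : 0 < ε) :
    IntegrableOn (fun t : ℝ => (1 + t) ^ s * t ^ (-(1 + 2 * s))) (Ioi ε) ∧
    ∫ t in Ioi ε, (1 + t) ^ s * t ^ (-(1 + 2 * s)) =
      ∫ t in Ioo (ε / (1 + ε)) 1, (1 - t) ^ (s - 1) * t ^ (-(1 + 2 * s)) := by
  set a := ε / (1 + ε) with ha
  have ha0 : 0 < a := by positivity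
  have ha1 : a < 1 := by rw [ha, div_lt_one (by positivity)]; linarith
  have himg : (fun t : ℝ => t / (1 - t)) '' Ioo a 1 = Ioi ε := by
    ext y
    constructor
    · rintro ⟨t, ht, rfl⟩
      have ht1 : 0 < 1 - t := by linarith [ht.2]
      have h1 := ht.1
      rw [ha, div_lt_iff₀ (by positivity)] at h1
      show ε < t / (1 - t)
      rw [lt_div_iff₀ ht1]
      linarith
    · intro (hy : ε < y)
      have hy0 : 0 < 1 + y := by linarith
      refine ⟨y / (1 + y), ⟨?_, ?_⟩, ?_⟩
      · rw [ha, div_lt_div_iff₀ (by positivity) hy0]; linarith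
      · rw [div_lt_one hy0]; linarith
      · show y / (1 + y) / (1 - y / (1 + y)) = y
        have : 1 - y / (1 + y) = 1 / (1 + y) := by field_simp; ring
        rw [this]; field_simp
  have hder : ∀ t ∈ Ioo a 1,
      HasDerivWithinAt (fun t : ℝ => t / (1 - t)) (1 / (1 - t) ^ 2) (Ioo a 1) t := by
    intro t ht
    have ht1 : 0 < 1 - t := by linarith [ht.2]
    have := (hasDerivAt_id t).div ((hasDerivAt_id t).const_sub 1) ht1.ne'
    refine (this.congr_deriv ?_).hasDerivWithinAt
    simp
  have hinj : InjOn (fun t : ℝ => t / (1 - t)) (Ioo a 1) := by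
    intro t ht u hu h
    have ht1 : 0 < 1 - t := by linarith [ht.2]
    have hu1 : 0 < 1 - u := by linarith [hu.2]
    have h' : t / (1 - t) = u / (1 - u) := h
    rw [div_eq_div_iff ht1.ne' hu1.ne'] at h'
    linarith
  have hcongr : EqOn (fun t : ℝ => |1 / (1 - t) ^ 2| •
      ((1 + t / (1 - t)) ^ s * (t / (1 - t)) ^ (-(1 + 2 * s))))
      (fun t : ℝ => (1 - t) ^ (s - 1) * t ^ (-(1 + 2 * s))) (Ioo a 1) := by
    intro t ht
    have ht0 : 0 < t := ha0.trans ht.1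
    have ht1 : 0 < 1 - t := by linarith [ht.2]
    have e1 : 1 + t / (1 - t) = (1 - t)⁻¹ := by field_simp; ring
    have e2 : |1 / (1 - t) ^ 2| = (1 - t) ^ (-2 : ℝ) := by
      rw [abs_of_pos (by positivity), Real.rpow_neg ht1.le, one_div]; norm_cast
    simp only [smul_eq_mul]
    rw [e1, e2, div_eq_mul_inv t, Real.mul_rpow ht0.le (by positivity), Real.inv_rpow ht1.le,
      Real.inv_rpow ht1.le, ← Real.rpow_neg ht1.le, ← Real.rpow_neg ht1.le]
    have e3 : (1 - t) ^ (s - 1) = (1 - t) ^ (-2 : ℝ) * ((1 - t) ^ (-s) *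
        (1 - t) ^ (-(-(1 + 2 * s)))) := by
      rw [← Real.rpow_add ht1, ← Real.rpow_add ht1]; congr 1; ring
    rw [e3]; ring
  constructor
  · rw [← himg, integrableOn_image_iff_integrableOn_abs_deriv_smul measurableSet_Ioo hder hinj]
    exact (integrableOn_congr_fun hcongr measurableSet_Ioo).2 (unit_kernels_integral hs ha0 ha1).1
  · rw [← himg, integral_image_eq_integral_abs_deriv_smul measurableSet_Ioo hder hinj]
    exact setIntegral_congr_fun measurableSet_Ioo hcongr

theorem one_sub_rpow_lower {s ε : ℝ} (hs : 0 < s) (hs1 : s < 1) (hε : 0 < ε) (hε1 : ε < 1) :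
    -(ε / (1 - ε)) ≤ (1 / s) * ((1 - ε) ^ s - 1) := by
  have h1 : 0 < 1 - ε := by linarith
  have hx : 0 < (1 - ε) ^ s := Real.rpow_pos_of_pos h1 s
  have h2 : ((1 - ε)⁻¹) ^ s ≤ 1 + s * (ε / (1 - ε)) := by
    have := rpow_one_add_le_one_add_mul_self (s := ε / (1 - ε)) (p := s)
      (by have : 0 ≤ ε / (1 - ε) := by positivity
          linarith) hs.le hs1.le
    have e : 1 + ε / (1 - ε) = (1 - ε)⁻¹ := by field_simp; ring
    rwa [e] at this
  rw [Real.inv_rpow h1.le] at h2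
  have h3 : (1 - ε) ^ s ≤ 1 := Real.rpow_le_one h1.le (by linarith) hs.le
  have h4 : 1 ≤ (1 + s * (ε / (1 - ε))) * (1 - ε) ^ s := by
    rwa [inv_le_iff_one_le_mul₀ hx] at h2
  have h5 : 0 ≤ s * (ε / (1 - ε)) := by positivity
  rw [one_div, inv_mul_eq_div, le_div_iff₀ hs]
  nlinarith

/-- Truncated form of the `α`-harmonicity of `x_+^{α/2}`, with `α = 2 s`. -/
theorem truncated_second_difference_lower {s ε : ℝ} (hs : 0 < s) (hs1 : s < 1)
    (hε : 0 < ε) (hε1 : ε < 1) :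
    -(2 * ε ^ (2 - 2 * s) / (1 - ε ^ 2)) ≤
      ∫ t in Ioi ε, (max (1 + t) 0 ^ s + max (1 - t) 0 ^ s - 2) * t ^ (-(1 + 2 * s)) := by
  obtain ⟨hA, hA'⟩ := tail_kernel_integral hs hε
  obtain ⟨hf, hg, hfg⟩ := unit_kernels_integral hs hε hε1
  have ha0 : 0 < ε / (1 + ε) := by positivity
  have ha1 : ε / (1 + ε) < 1 := by rw [div_lt_one (by positivity)]; linarith
  have haε : ε / (1 + ε) < ε := by
    rw [div_lt_iff₀ (by positivity)]; nlinarith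
  obtain ⟨hf', -, -⟩ := unit_kernels_integral hs ha0 ha1
  have hind : ∀ t ∈ Ioi ε, (max (1 + t) 0 ^ s + max (1 - t) 0 ^ s - 2) * t ^ (-(1 + 2 * s)) =
      ((1 + t) ^ s * t ^ (-(1 + 2 * s)) +
        (Ioo ε 1).indicator (fun t => (1 - t) ^ s * t ^ (-(1 + 2 * s))) t)
        - 2 * t ^ (-(1 + 2 * s)) := by
    intro t (ht : ε < t)
    rw [max_eq_left (by linarith : (0 : ℝ) ≤ 1 + t)]
    by_cases h : t < 1
    · rw [max_eq_left (by linarith : (0 : ℝ) ≤ 1 - t), indicator_of_mem (show t ∈ Ioo ε 1 from ⟨ht, h⟩)]; ring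
    · rw [max_eq_right (by linarith : 1 - t ≤ 0), indicator_of_notMem (fun h' => h h'.2),
        Real.zero_rpow hs.ne']; ring
  rw [setIntegral_congr_fun measurableSet_Ioi hind]
  have hI1 : IntegrableOn ((Ioo ε 1).indicator (fun t => (1 - t) ^ s * t ^ (-(1 + 2 * s))))
      (Ioi ε) := ((integrable_indicator_iff measurableSet_Ioo).2 hg).integrableOn
  have hI2 : IntegrableOn (fun t : ℝ => 2 * t ^ (-(1 + 2 * s))) (Ioi ε) :=
    (integrableOn_Ioi_rpow_of_lt (by linarith) hε).const_mul 2
  have hAI : IntegrableOn (fun t : ℝ => (1 + t) ^ s * t ^ (-(1 + 2 * s)) +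
      (Ioo ε 1).indicator (fun t => (1 - t) ^ s * t ^ (-(1 + 2 * s))) t) (Ioi ε) := hA.add hI1
  rw [integral_sub hAI hI2, integral_add hA hI1, setIntegral_indicator measurableSet_Ioo,
    integral_const_mul, integral_Ioi_rpow_of_lt (by linarith) hε, hA']
  have hinter : Ioi ε ∩ Ioo ε 1 = Ioo ε 1 := inter_eq_right.2 fun t ht => ht.1
  rw [hinter]
  have hsplit : (∫ t in Ioo ε 1, (1 - t) ^ (s - 1) * t ^ (-(1 + 2 * s))) +
      ε ^ (-(1 + 2 * s)) * (ε - ε / (1 + ε)) ≤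
      ∫ t in Ioo (ε / (1 + ε)) 1, (1 - t) ^ (s - 1) * t ^ (-(1 + 2 * s)) := by
    have hu : Ioc (ε / (1 + ε)) ε ∪ Ioo ε 1 = Ioo (ε / (1 + ε)) 1 := Ioc_union_Ioo_eq_Ioo haε.le hε1
    have hd : Disjoint (Ioc (ε / (1 + ε)) ε) (Ioo ε 1) := by
      rw [Set.disjoint_left]; intro t h1 h2; exact absurd h2.1 (not_lt.2 h1.2)
    have hfl : IntegrableOn (fun t : ℝ => (1 - t) ^ (s - 1) * t ^ (-(1 + 2 * s)))
        (Ioc (ε / (1 + ε)) ε) := hf'.mono_set (hu ▸ subset_union_left)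
    rw [← hu, setIntegral_union hd measurableSet_Ioo hfl hf, add_comm]
    gcongr
    have hc : ∫ t in Ioc (ε / (1 + ε)) ε, ε ^ (-(1 + 2 * s)) =
        ε ^ (-(1 + 2 * s)) * (ε - ε / (1 + ε)) := by
      simp [haε.le, mul_comm]
    rw [← hc]
    refine setIntegral_mono_on (by simp) hfl measurableSet_Ioc fun t ht => ?_
    have ht0 : 0 < t := ha0.trans ht.1
    have h1 : 1 ≤ (1 - t) ^ (s - 1) :=
      Real.one_le_rpow_of_pos_of_le_one_of_nonpos (by linarith [ht.2]) (by linarith) (by linarith)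
    have h2 : ε ^ (-(1 + 2 * s)) ≤ t ^ (-(1 + 2 * s)) :=
      Real.rpow_le_rpow_of_nonpos ht0 ht.2 (by linarith)
    have h3 : 0 < ε ^ (-(1 + 2 * s)) := by positivity
    nlinarith
  set P := ε ^ (-(2 * s)) with hP
  have hP0 : 0 < P := by positivity
  have e1 : ε ^ (-(1 + 2 * s)) = P / ε := by
    rw [hP, ← Real.rpow_sub_one hε.ne']; congr 1; ring
  have e2 : ε ^ (2 - 2 * s) = P * ε ^ 2 := by
    rw [hP, ← Real.rpow_natCast, ← Real.rpow_add hε]; congr 1; push_cast; ring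
  have e3 : ε ^ (-(1 + 2 * s) + 1) = P := by rw [hP]; congr 1; ring
  rw [e3]
  rw [e1] at hsplit
  rw [e2]
  have hb := mul_le_mul_of_nonneg_left (one_sub_rpow_lower hs hs1 hε hε1) hP0.le
  have e4 : P / ε * (ε - ε / (1 + ε)) = P * (ε / (1 + ε)) := by field_simp; ring
  have e5 : 2 * (-P / (-(1 + 2 * s) + 1)) = 1 / s * P := by
    rw [show -(1 + 2 * s) + 1 = -(2 * s) by ring]; field_simp
  have e6 : P * (ε / (1 + ε)) + P * -(ε / (1 - ε)) = -(2 * (P * ε ^ 2) / (1 - ε ^ 2)) := by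
    have h1 : 1 - ε ≠ 0 := by linarith
    have h2 : 1 - ε ^ 2 ≠ 0 := by nlinarith
    have h3 : 1 - ε ^ 2 = (1 - ε) * (1 + ε) := by ring
    rw [h3]; field_simp; ring
  have e7 : P * (1 / s * ((1 - ε) ^ s - 1)) = 1 / s * ((1 - ε) ^ s * P) - 1 / s * P := by ring
  rw [e4] at hsplit
  rw [e5, ← e6]
  linarith

theorem second_difference_integral_nonneg {s : ℝ} (hs : 0 < s) (hs1 : s < 1) :
    0 ≤ ∫ t in Ioi (0 : ℝ),
      (max (1 + t) 0 ^ s + max (1 - t) 0 ^ s - 2) * t ^ (-(1 + 2 * s)) := by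
  set g : ℝ → ℝ := fun t =>
    (max (1 + t) 0 ^ s + max (1 - t) 0 ^ s - 2) * t ^ (-(1 + 2 * s)) with hg
  by_cases hi : IntegrableOn g (Ioi 0)
  swap
  · rw [integral_undef hi]
  have hlim : Tendsto (fun ε : ℝ => ε) (𝓝[>] 0) (𝓝 0) := nhdsWithin_le_nhds
  have hcov := aecover_Ioi_of_Ioi (μ := (volume : Measure ℝ)) hlim
  have h1 := hcov.integral_tendsto_of_countably_generated hi
  have h2 : Tendsto (fun ε : ℝ => -(2 * ε ^ (2 - 2 * s) / (1 - ε ^ 2))) (𝓝[>] 0) (𝓝 0) := by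
    have hc : ContinuousAt (fun ε : ℝ => -(2 * ε ^ (2 - 2 * s) / (1 - ε ^ 2))) 0 := by
      have : ContinuousAt (fun ε : ℝ => ε ^ (2 - 2 * s)) 0 :=
        Real.continuousAt_rpow_const _ _ (Or.inr (by linarith))
      exact ((continuousAt_const.mul this).div (by fun_prop) (by norm_num)).neg
    have h := hc.tendsto
    simp only [Real.zero_rpow (by linarith : 2 - 2 * s ≠ 0)] at h
    norm_num at h
    exact h.mono_left nhdsWithin_le_nhds
  refine le_of_tendsto_of_tendsto h2 h1 ?_
  filter_upwards [Ioo_mem_nhdsGT (show (0 : ℝ) < 1 by norm_num)] with ε hε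
  rw [Measure.restrict_restrict measurableSet_Ioi,
    inter_eq_left.2 (Ioi_subset_Ioi hε.1.le)]
  exact truncated_second_difference_lower hs hs1 hε.1 hε.2

section Norm

variable {m : ℕ}

theorem enorm'_nonneg (z : EuclideanSpace ℝ (Fin m) × ℝ) : 0 ≤ enorm' z := Real.sqrt_nonneg _

theorem enorm'_sq (z : EuclideanSpace ℝ (Fin m) × ℝ) : enorm' z ^ 2 = ‖z.1‖ ^ 2 + z.2 ^ 2 :=
  Real.sq_sqrt (by positivity)

theorem norm_le_enorm' (z : EuclideanSpace ℝ (Fin m) × ℝ) : ‖z‖ ≤ enorm' z := by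
  rw [Prod.norm_def]
  refine max_le (Real.le_sqrt_of_sq_le ?_) (Real.le_sqrt_of_sq_le ?_)
  · nlinarith [sq_nonneg z.2]
  · rw [Real.norm_eq_abs, sq_abs]; nlinarith [sq_nonneg ‖z.1‖]

theorem norm_fst_le_norm (z : EuclideanSpace ℝ (Fin m) × ℝ) : ‖z.1‖ ≤ ‖z‖ := by
  rw [Prod.norm_def]; exact le_max_left _ _

theorem abs_snd_le_norm (z : EuclideanSpace ℝ (Fin m) × ℝ) : |z.2| ≤ ‖z‖ := by
  rw [Prod.norm_def]; exact le_max_right _ _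

theorem enorm'_le_two_mul_norm (z : EuclideanSpace ℝ (Fin m) × ℝ) : enorm' z ≤ 2 * ‖z‖ := by
  refine Real.sqrt_le_iff.2 ⟨by positivity, ?_⟩
  have h1 := norm_fst_le_norm z
  have h2 := abs_snd_le_norm z
  nlinarith [sq_abs z.2, norm_nonneg z.1, abs_nonneg z.2]

theorem enorm'_neg (z : EuclideanSpace ℝ (Fin m) × ℝ) : enorm' (-z) = enorm' z := by
  simp [enorm']

theorem enorm'_smul (c : ℝ) (z : EuclideanSpace ℝ (Fin m) × ℝ) :
    enorm' (c • z) = |c| * enorm' z := by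
  simp only [enorm', Prod.smul_fst, Prod.smul_snd, norm_smul, Real.norm_eq_abs, smul_eq_mul]
  rw [← Real.sqrt_sq (abs_nonneg c), ← Real.sqrt_mul (sq_nonneg _), Real.sqrt_sq (abs_nonneg c)]
  congr 1
  rw [mul_pow, mul_pow, sq_abs]
  ring

theorem measurable_enorm' : Measurable (enorm' : EuclideanSpace ℝ (Fin m) × ℝ → ℝ) := by
  unfold enorm'
  fun_prop

theorem enorm'_pos {z : EuclideanSpace ℝ (Fin m) × ℝ} (hz : z ≠ 0) : 0 < enorm' z :=
  (norm_pos_iff.2 hz).trans_le (norm_le_enorm' z)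

theorem finrank_prod_real : Module.finrank ℝ (EuclideanSpace ℝ (Fin m) × ℝ) = m + 1 := by
  simp

end Norm

/-- The kernel `|z|^{-d-α}` on `ℝ^m × ℝ`, with `d = m + 1`. -/
noncomputable def rieszKernel {m : ℕ} (α : ℝ) (z : EuclideanSpace ℝ (Fin m) × ℝ) : ℝ :=
  (enorm' z ^ ((m : ℝ) + 1 + α))⁻¹

section Kernel

variable {m : ℕ}

theorem rieszKernel_nonneg (α : ℝ) (z : EuclideanSpace ℝ (Fin m) × ℝ) : 0 ≤ rieszKernel α z :=
  inv_nonneg.2 (Real.rpow_nonneg (enorm'_nonneg z) _)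

theorem rieszKernel_neg (α : ℝ) (z : EuclideanSpace ℝ (Fin m) × ℝ) :
    rieszKernel α (-z) = rieszKernel α z := by
  rw [rieszKernel, enorm'_neg, rieszKernel]

theorem measurable_rieszKernel (α : ℝ) :
    Measurable (rieszKernel α : EuclideanSpace ℝ (Fin m) × ℝ → ℝ) :=
  (measurable_enorm'.pow_const _).inv

theorem rieszKernel_smul (α : ℝ) (c : ℝ) (z : EuclideanSpace ℝ (Fin m) × ℝ) :
    rieszKernel α (c • z) = |c| ^ (-((m : ℝ) + 1 + α)) * rieszKernel α z := by
  rw [rieszKernel, enorm'_smul, Real.mul_rpow (abs_nonneg c) (enorm'_nonneg z), mul_inv,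
    Real.rpow_neg (abs_nonneg c), rieszKernel]

theorem rieszKernel_le {α : ℝ} (hα : 0 < α) (z : EuclideanSpace ℝ (Fin m) × ℝ) :
    rieszKernel α z ≤ (‖z‖ ^ ((m : ℝ) + 1 + α))⁻¹ := by
  by_cases hz : z = 0
  · subst hz
    have : enorm' (0 : EuclideanSpace ℝ (Fin m) × ℝ) = 0 := by simp [enorm']
    rw [rieszKernel, this, norm_zero]
  · have := norm_pos_iff.2 hz
    unfold rieszKernel
    gcongr
    exact norm_le_enorm' z

end Kernel

/-- The size profile of second differences of the `p`-th power of a regularized distance. -/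
noncomputable def profile (p τ : ℝ) : ℝ := if τ ≤ 1 / 8 then τ ^ 2 else τ ^ p

theorem profile_nonneg (p : ℝ) {τ : ℝ} (hτ : 0 ≤ τ) : 0 ≤ profile p τ := by
  unfold profile
  split_ifs <;> positivity

theorem measurable_profile (p : ℝ) : Measurable (profile p) :=
  Measurable.ite measurableSet_Iic (by fun_prop) (by fun_prop)

instance isAddHaarMeasure_volume_prod_real (m : ℕ) :
    (volume : Measure (EuclideanSpace ℝ (Fin m) × ℝ)).IsAddHaarMeasure :=
  inferInstanceAs
    ((volume : Measure (EuclideanSpace ℝ (Fin m))).prod (volume : Measure ℝ)).IsAddHaarMeasure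

section ProfileIntegral

variable {m : ℕ}

theorem integrable_profile {p α : ℝ} (hpα : p < α) (hα2 : α < 2) :
    Integrable (fun z : EuclideanSpace ℝ (Fin m) × ℝ =>
      profile p ‖z‖ * (‖z‖ ^ ((m : ℝ) + 1 + α))⁻¹) := by
  rw [integrable_fun_norm_addHaar volume
    (f := fun r : ℝ => profile p r * (r ^ ((m : ℝ) + 1 + α))⁻¹), finrank_prod_real,
    Nat.add_sub_cancel]
  have hu : Ioc (0 : ℝ) (1 / 8) ∪ Ioi (1 / 8) = Ioi 0 := Ioc_union_Ioi_eq_Ioi (by norm_num)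
  have hk : ∀ y : ℝ, 0 < y → ∀ q : ℝ,
      y ^ m * (y ^ q * (y ^ ((m : ℝ) + 1 + α))⁻¹) = y ^ (q - 1 - α) := by
    intro y hy q
    rw [← Real.rpow_natCast, ← Real.rpow_neg hy.le, ← Real.rpow_add hy, ← Real.rpow_add hy]
    congr 1; ring
  rw [← hu, integrableOn_union]
  constructor
  · have h : IntegrableOn (fun y : ℝ => y ^ (1 - α)) (Ioc 0 (1 / 8)) :=
      (intervalIntegrable_iff_integrableOn_Ioc_of_le (by norm_num)).1
        (intervalIntegral.intervalIntegrable_rpow' (by linarith))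
    refine (integrableOn_congr_fun (fun y hy => ?_) measurableSet_Ioc).2 h
    simp only [smul_eq_mul, profile, if_pos hy.2]
    rw [← Real.rpow_two, hk y hy.1]
    congr 1; ring
  · have h : IntegrableOn (fun y : ℝ => y ^ (p - 1 - α)) (Ioi (1 / 8)) :=
      integrableOn_Ioi_rpow_of_lt (by linarith) (by norm_num)
    refine (integrableOn_congr_fun (fun y hy => ?_) measurableSet_Ioi).2 h
    have hy' : (1 / 8 : ℝ) < y := hy
    simp only [smul_eq_mul, profile, if_neg (not_le.2 hy')]
    exact hk y (by linarith) p

theorem integral_scaled_profile {p α : ℝ} (hα0 : 0 < α) (hpα : p < α) (hα2 : α < 2) {w : ℝ}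
    (hw : 0 < w) :
    Integrable (fun z : EuclideanSpace ℝ (Fin m) × ℝ =>
      profile p (‖z‖ / w) * rieszKernel α z) ∧
    ∫ z : EuclideanSpace ℝ (Fin m) × ℝ, profile p (‖z‖ / w) * rieszKernel α z ≤
      w ^ (-α) * ∫ z : EuclideanSpace ℝ (Fin m) × ℝ,
        profile p ‖z‖ * (‖z‖ ^ ((m : ℝ) + 1 + α))⁻¹ := by
  set F : EuclideanSpace ℝ (Fin m) × ℝ → ℝ :=
    fun z => profile p ‖z‖ * (‖z‖ ^ ((m : ℝ) + 1 + α))⁻¹ with hF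
  have hFi : Integrable F := integrable_profile hpα hα2
  have hle : ∀ z : EuclideanSpace ℝ (Fin m) × ℝ, profile p (‖z‖ / w) * rieszKernel α z ≤
      w ^ (-((m : ℝ) + 1 + α)) * F (w⁻¹ • z) := by
    intro z
    have e : ‖w⁻¹ • z‖ = ‖z‖ / w := by
      rw [norm_smul, Real.norm_of_nonneg (by positivity)]; ring
    have hkey : w ^ (-((m : ℝ) + 1 + α)) * ((‖z‖ / w) ^ ((m : ℝ) + 1 + α))⁻¹ =
        (‖z‖ ^ ((m : ℝ) + 1 + α))⁻¹ := by
      rw [Real.div_rpow (norm_nonneg z) hw.le, Real.rpow_neg hw.le]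
      have : 0 < w ^ ((m : ℝ) + 1 + α) := by positivity
      field_simp
    simp only [hF]
    rw [e, mul_left_comm, hkey]
    exact mul_le_mul_of_nonneg_left (rieszKernel_le hα0 z) (profile_nonneg _ (by positivity))
  have hi : Integrable (fun z => w ^ (-((m : ℝ) + 1 + α)) * F (w⁻¹ • z)) :=
    (hFi.comp_smul (inv_ne_zero hw.ne')).const_mul _
  have hmeas : Measurable (fun z : EuclideanSpace ℝ (Fin m) × ℝ =>
      profile p (‖z‖ / w) * rieszKernel α z) :=
    ((measurable_profile p).comp (by fun_prop)).mul (measurable_rieszKernel α)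
  have hint : Integrable (fun z : EuclideanSpace ℝ (Fin m) × ℝ =>
      profile p (‖z‖ / w) * rieszKernel α z) := by
    refine hi.mono' hmeas.aestronglyMeasurable (Eventually.of_forall fun z => ?_)
    rw [Real.norm_of_nonneg
      (mul_nonneg (profile_nonneg _ (by positivity)) (rieszKernel_nonneg _ _))]
    exact hle z
  refine ⟨hint, (integral_mono hint hi hle).trans (le_of_eq ?_)⟩
  rw [integral_const_mul, Measure.integral_comp_smul, finrank_prod_real, smul_eq_mul,
    abs_of_pos (by positivity), ← mul_assoc]
  congr 1
  rw [inv_pow, inv_inv, ← Real.rpow_natCast, ← Real.rpow_add hw]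
  congr 1; push_cast; ring

end ProfileIntegral

theorem abs_one_add_rpow_sub_le {p a : ℝ} (hp0 : 0 < p) (hp2 : p < 2) (ha : |a| ≤ 1 / 2) :
    |(1 + a) ^ p - 1 - p * a| ≤ 2 * a ^ 2 := by
  obtain ⟨ha1, ha2⟩ := abs_le.1 ha
  have h1 : 0 < 1 + a := by linarith
  rw [abs_le]
  rcases le_total 1 p with hp | hp
  · have hlow := one_add_mul_self_le_rpow_one_add (s := a) (by linarith) hp
    have hup := rpow_one_add_le_one_add_mul_self (s := a) (p := p - 1) (by linarith)
      (by linarith) (by linarith)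
    rw [Real.rpow_sub_one h1.ne', div_le_iff₀ h1] at hup
    constructor <;> nlinarith [sq_nonneg a]
  · have hup := rpow_one_add_le_one_add_mul_self (s := a) (p := p) (by linarith) hp0.le hp
    have hlow := one_add_mul_self_le_rpow_one_add (s := a) (p := p + 1) (by linarith) (by linarith)
    rw [Real.rpow_add_one h1.ne'] at hlow
    constructor
    · have h2 : (1 + p * a - 2 * a ^ 2) * (1 + a) ≤ (1 + a) ^ p * (1 + a) := by
        nlinarith [sq_nonneg a]
      linarith [le_of_mul_le_mul_right h2 h1]
    · nlinarith [sq_nonneg a]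

/-- The second difference of `u` at the origin. -/
noncomputable def secondDiff {m : ℕ} (u : EuclideanSpace ℝ (Fin m) × ℝ → ℝ)
    (z : EuclideanSpace ℝ (Fin m) × ℝ) : ℝ := u z + u (-z) - 2 * u 0

/-- `u` looks, around the origin, like the `p`-th power of a distance to a boundary which lies at
distance comparable to `w` from the origin. -/
structure IsPowerLike {m : ℕ} (p w : ℝ) (u : EuclideanSpace ℝ (Fin m) × ℝ → ℝ) : Prop where
  measurable : Measurable u
  apply_zero : u 0 = w ^ p
  nonneg : ∀ z, 0 ≤ u z
  le : ∀ z, u z ≤ (w + 2 * ‖z‖) ^ p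
  expansion : ∃ n Q : EuclideanSpace ℝ (Fin m) × ℝ → ℝ, (∀ z, n (-z) = -n z) ∧
    (∀ z, |n z| ≤ 2 * ‖z‖) ∧
    ∀ z, ‖z‖ ≤ w / 8 → w * |Q z| ≤ ‖z‖ ^ 2 ∧ u z = (w + n z + Q z) ^ p

namespace IsPowerLike

variable {m : ℕ} {p w : ℝ} {u : EuclideanSpace ℝ (Fin m) × ℝ → ℝ}

theorem abs_secondDiff_le (h : IsPowerLike p w u) (hp0 : 0 < p) (hp2 : p < 2) (hw : 0 < w)
    (z : EuclideanSpace ℝ (Fin m) × ℝ) :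
    |secondDiff u z| ≤ 400 * w ^ p * profile p (‖z‖ / w) := by
  have hwp : 0 < w ^ p := by positivity
  set τ := ‖z‖ / w with hτ
  have hτ0 : 0 ≤ τ := by positivity
  have hz : ‖z‖ = τ * w := by rw [hτ]; field_simp
  by_cases hc : τ ≤ 1 / 8
  · rw [profile, if_pos hc]
    obtain ⟨n, Q, hodd, hn, hQ⟩ := h.expansion
    have hz8 : ‖z‖ ≤ w / 8 := by rw [hz]; nlinarith
    have key : ∀ y : EuclideanSpace ℝ (Fin m) × ℝ, ‖y‖ = τ * w → |Q y / w| ≤ τ ^ 2 ∧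
        |u y - w ^ p - w ^ p * (p * ((n y + Q y) / w))| ≤ w ^ p * (18 * τ ^ 2) := by
      intro y hy
      obtain ⟨hQy, huy⟩ := hQ y (by rw [hy, ← hz]; exact hz8)
      have hny := hn y
      rw [hy] at hQy hny
      have hQ' : |Q y / w| ≤ τ ^ 2 := by
        rw [abs_div, abs_of_pos hw, div_le_iff₀ hw]
        have : w * |Q y| ≤ w * (τ ^ 2 * w) := by linarith
        exact le_of_mul_le_mul_left this hw
      have hn' : |n y / w| ≤ 2 * τ := by
        rw [abs_div, abs_of_pos hw, div_le_iff₀ hw]; linarith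
      have ha : |(n y + Q y) / w| ≤ 3 * τ := by
        rw [add_div]
        refine (abs_add_le _ _).trans ?_
        nlinarith
      have ha2 : |(n y + Q y) / w| ≤ 1 / 2 := by linarith
      refine ⟨hQ', ?_⟩
      have e : u y = w ^ p * (1 + (n y + Q y) / w) ^ p := by
        rw [huy, ← Real.mul_rpow hw.le (by linarith [(abs_le.1 ha2).1])]
        congr 1; field_simp; ring
      have e2 : u y - w ^ p - w ^ p * (p * ((n y + Q y) / w)) =
          w ^ p * ((1 + (n y + Q y) / w) ^ p - 1 - p * ((n y + Q y) / w)) := by rw [e]; ring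
      rw [e2, abs_mul, abs_of_pos hwp]
      refine mul_le_mul_of_nonneg_left ((abs_one_add_rpow_sub_le hp0 hp2 ha2).trans ?_) hwp.le
      nlinarith [sq_abs ((n y + Q y) / w), abs_nonneg ((n y + Q y) / w)]
    obtain ⟨hq1, h1⟩ := key z hz
    obtain ⟨hq2, h2⟩ := key (-z) (by rw [norm_neg]; exact hz)
    rw [hodd] at h2
    have e : secondDiff u z = (u z - w ^ p - w ^ p * (p * ((n z + Q z) / w))) +
        (u (-z) - w ^ p - w ^ p * (p * ((-n z + Q (-z)) / w))) +
        w ^ p * (p * (Q z / w + Q (-z) / w)) := by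
      rw [secondDiff, h.apply_zero]; ring
    have h3 : |w ^ p * (p * (Q z / w + Q (-z) / w))| ≤ w ^ p * (4 * τ ^ 2) := by
      rw [abs_mul, abs_of_pos hwp, abs_mul, abs_of_pos hp0]
      refine mul_le_mul_of_nonneg_left ?_ hwp.le
      have := abs_add_le (Q z / w) (Q (-z) / w)
      nlinarith [abs_nonneg (Q z / w + Q (-z) / w)]
    rw [e]
    refine (abs_add_three _ _ _).trans ?_
    nlinarith [mul_nonneg hwp.le (sq_nonneg τ)]
  · rw [profile, if_neg hc]
    push Not at hc
    have hτp : 0 < τ := by linarith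
    have hτP : 0 < τ ^ p := by positivity
    have key : ∀ y : EuclideanSpace ℝ (Fin m) × ℝ, ‖y‖ = τ * w →
        u y ≤ w ^ p * (100 * τ ^ p) := by
      intro y hy
      refine (h.le y).trans ?_
      have e : w + 2 * ‖y‖ ≤ w * (10 * τ) := by rw [hy]; nlinarith
      refine (Real.rpow_le_rpow (by positivity) e hp0.le).trans ?_
      rw [Real.mul_rpow hw.le (by positivity), Real.mul_rpow (by norm_num) hτp.le]
      gcongr
      have := Real.rpow_le_rpow_of_exponent_le (show (1 : ℝ) ≤ 10 by norm_num) hp2.le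
      norm_num at this
      exact this
    have h1 := key z hz
    have h2 := key (-z) (by rw [norm_neg]; exact hz)
    have h0 : u 0 ≤ w ^ p * (100 * τ ^ p) := by
      have h8 : w ≤ w * (10 * τ) := by nlinarith
      rw [h.apply_zero]
      refine (Real.rpow_le_rpow hw.le h8 hp0.le).trans ?_
      rw [Real.mul_rpow hw.le (by positivity), Real.mul_rpow (by norm_num) hτp.le]
      gcongr
      have := Real.rpow_le_rpow_of_exponent_le (show (1 : ℝ) ≤ 10 by norm_num) hp2.le
      norm_num at this
      exact this
    have n1 := h.nonneg z
    have n2 := h.nonneg (-z)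
    have n0 := h.nonneg 0
    rw [secondDiff, abs_le]
    constructor <;> nlinarith [mul_pos hwp hτP]

theorem measurable_secondDiff (h : IsPowerLike p w u) : Measurable (secondDiff u) := by
  have := h.measurable
  unfold secondDiff
  fun_prop

theorem integrable_secondDiff {α : ℝ} (h : IsPowerLike p w u) (hp0 : 0 < p) (hpα : p < α)
    (hα2 : α < 2) (hw : 0 < w) :
    Integrable (fun z => secondDiff u z * rieszKernel α z) := by
  have hb := (integral_scaled_profile (m := m) (hp0.trans hpα) hpα hα2 hw).1
  refine (hb.const_mul (400 * w ^ p)).mono'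
    (h.measurable_secondDiff.mul (measurable_rieszKernel α)).aestronglyMeasurable
    (Eventually.of_forall fun z => ?_)
  rw [Real.norm_eq_abs, abs_mul, abs_of_nonneg (rieszKernel_nonneg α z), ← mul_assoc]
  exact mul_le_mul_of_nonneg_right (h.abs_secondDiff_le hp0 (hpα.trans hα2) hw z)
    (rieszKernel_nonneg α z)

theorem integral_secondDiff_le {α : ℝ} (h : IsPowerLike p w u) (hp0 : 0 < p) (hpα : p < α)
    (hα2 : α < 2) (hw : 0 < w) :
    ∫ z, secondDiff u z * rieszKernel α z ≤
      (400 * ∫ z : EuclideanSpace ℝ (Fin m) × ℝ,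
        profile p ‖z‖ * (‖z‖ ^ ((m : ℝ) + 1 + α))⁻¹) * w ^ (p - α) := by
  obtain ⟨hb, hb'⟩ := integral_scaled_profile (m := m) (hp0.trans hpα) hpα hα2 hw
  have hwp : 0 < w ^ p := by positivity
  refine (integral_mono (h.integrable_secondDiff hp0 hpα hα2 hw) (hb.const_mul (400 * w ^ p))
    fun z => ?_).trans ?_
  · rw [← mul_assoc]
    exact mul_le_mul_of_nonneg_right
      ((le_abs_self _).trans (h.abs_secondDiff_le hp0 (hpα.trans hα2) hw z))
      (rieszKernel_nonneg α z)
  · rw [integral_const_mul]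
    refine (mul_le_mul_of_nonneg_left hb' (by positivity)).trans (le_of_eq ?_)
    rw [sub_eq_add_neg p α, Real.rpow_add hw]
    ring

theorem integrableOn_truncated {α : ℝ} (h : IsPowerLike p w u) (hp0 : 0 < p) (hpα : p < α)
    (hα2 : α < 2) (hw : 0 < w) {ε : ℝ} (hε : 0 < ε) :
    IntegrableOn (fun z => (u z - u 0) * rieszKernel α z)
      {z : EuclideanSpace ℝ (Fin m) × ℝ | ε < enorm' z} := by
  have hb := (integral_scaled_profile (m := m) (hp0.trans hpα) hpα hα2 hε).1
  have hS : MeasurableSet {z : EuclideanSpace ℝ (Fin m) × ℝ | ε < enorm' z} :=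
    measurableSet_lt measurable_const measurable_enorm'
  refine (hb.const_mul ((2 * w + 2 * ε) ^ p)).integrableOn.mono'
    ((h.measurable.sub_const _).mul (measurable_rieszKernel α)).aestronglyMeasurable ?_
  filter_upwards [ae_restrict_mem hS] with z hz
  have hz' : ε / 2 < ‖z‖ := by
    have : ε < enorm' z := hz
    linarith [enorm'_le_two_mul_norm z]
  rw [Real.norm_eq_abs, abs_mul, abs_of_nonneg (rieszKernel_nonneg α z), ← mul_assoc]
  refine mul_le_mul_of_nonneg_right ?_ (rieszKernel_nonneg α z)
  have hτ : 1 / 2 < ‖z‖ / ε := by rw [lt_div_iff₀ hε]; linarith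
  rw [profile, if_neg (by linarith), ← Real.mul_rpow (by positivity) (by positivity)]
  have e1 : w + 2 * ‖z‖ ≤ (2 * w + 2 * ε) * (‖z‖ / ε) := by
    have : (2 * w + 2 * ε) * (‖z‖ / ε) = 2 * w * (‖z‖ / ε) + 2 * ‖z‖ := by field_simp
    rw [this]; nlinarith
  have h1 : u z ≤ ((2 * w + 2 * ε) * (‖z‖ / ε)) ^ p :=
    (h.le z).trans (Real.rpow_le_rpow (by positivity) e1 hp0.le)
  have h0 : u 0 ≤ ((2 * w + 2 * ε) * (‖z‖ / ε)) ^ p := by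
    rw [h.apply_zero]
    exact Real.rpow_le_rpow hw.le (by linarith [norm_nonneg z]) hp0.le
  have n1 := h.nonneg z
  have n0 := h.nonneg 0
  rw [abs_le]
  constructor <;> linarith

theorem tendsto_truncated {α : ℝ} (h : IsPowerLike p w u) (hp0 : 0 < p) (hpα : p < α)
    (hα2 : α < 2) (hw : 0 < w) :
    Tendsto (fun ε : ℝ => ∫ z in {z : EuclideanSpace ℝ (Fin m) × ℝ | ε < enorm' z},
      (u z - u 0) * rieszKernel α z) (𝓝[>] 0)
      (𝓝 ((1 / 2) * ∫ z, secondDiff u z * rieszKernel α z)) := by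
  have hS : ∀ ε : ℝ, MeasurableSet {z : EuclideanSpace ℝ (Fin m) × ℝ | ε < enorm' z} :=
    fun ε => measurableSet_lt measurable_const measurable_enorm'
  have hcov : AECover (volume : Measure (EuclideanSpace ℝ (Fin m) × ℝ)) (𝓝[>] (0 : ℝ))
      (fun ε => {z | ε < enorm' z}) := by
    refine ⟨?_, hS⟩
    have h0 : ∀ᵐ z : EuclideanSpace ℝ (Fin m) × ℝ, z ≠ 0 := by
      simp [ae_iff]
    filter_upwards [h0] with z hz
    exact nhdsWithin_le_nhds (Iio_mem_nhds (enorm'_pos hz))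
  have hlim := hcov.integral_tendsto_of_countably_generated
    (h.integrable_secondDiff hp0 hpα hα2 hw)
  refine (hlim.const_mul (1 / 2)).congr' ?_
  filter_upwards [self_mem_nhdsWithin] with ε (hε : 0 < ε)
  set f : EuclideanSpace ℝ (Fin m) × ℝ → ℝ :=
    {z | ε < enorm' z}.indicator fun z => (u z - u 0) * rieszKernel α z with hf
  have hfi : Integrable f :=
    (integrable_indicator_iff (hS ε)).2 (h.integrableOn_truncated hp0 hpα hα2 hw hε)
  have hsum : {z : EuclideanSpace ℝ (Fin m) × ℝ | ε < enorm' z}.indicator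
      (fun z => secondDiff u z * rieszKernel α z) = fun z => f z + f (-z) := by
    funext z
    by_cases hz : ε < enorm' z
    · have hz' : ε < enorm' (-z) := by rwa [enorm'_neg]
      simp only [hf, indicator, mem_ofPred_eq, if_pos hz, if_pos hz', secondDiff, rieszKernel_neg]
      ring
    · have hz' : ¬ ε < enorm' (-z) := by rwa [enorm'_neg]
      simp [hf, indicator, hz, hz']
  rw [← integral_indicator (hS ε), ← integral_indicator (hS ε), hsum,
    integral_add hfi hfi.comp_neg, integral_neg_eq_self]
  ring

end IsPowerLike

/-- The `s`-th power of the (affine) half-space function `w + z_d + ⟨b, z̃⟩`. -/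
noncomputable def halfSpacePow {m : ℕ} (s w : ℝ) (b : EuclideanSpace ℝ (Fin m))
    (z : EuclideanSpace ℝ (Fin m) × ℝ) : ℝ :=
  max (w + (z.2 + inner ℝ b z.1)) 0 ^ s

section HalfSpace

variable {m : ℕ}

theorem abs_snd_add_inner_le {b : EuclideanSpace ℝ (Fin m)} (hb : ‖b‖ ≤ 1)
    (z : EuclideanSpace ℝ (Fin m) × ℝ) : |z.2 + inner ℝ b z.1| ≤ 2 * ‖z‖ := by
  have h1 := abs_real_inner_le_norm b z.1
  have h2 := norm_fst_le_norm z
  have h3 := abs_snd_le_norm z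
  have h4 := abs_add_le z.2 (inner ℝ b z.1)
  nlinarith [norm_nonneg z.1]

theorem isPowerLike_halfSpacePow {s w : ℝ} (hs : 0 < s) (hw : 0 < w)
    {b : EuclideanSpace ℝ (Fin m)} (hb : ‖b‖ ≤ 1) : IsPowerLike s w (halfSpacePow s w b) where
  measurable := by unfold halfSpacePow; fun_prop
  apply_zero := by simp [halfSpacePow, hw.le]
  nonneg z := by unfold halfSpacePow; positivity
  le z := by
    unfold halfSpacePow
    refine Real.rpow_le_rpow (le_max_right _ _) (max_le ?_ (by positivity)) hs.le
    linarith [(abs_le.1 (abs_snd_add_inner_le hb z)).2]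
  expansion := by
    refine ⟨fun z => z.2 + inner ℝ b z.1, fun _ => 0, ?_, abs_snd_add_inner_le hb, ?_⟩
    · intro z; simp; ring
    · intro z hz
      refine ⟨by simp, ?_⟩
      rw [halfSpacePow, max_eq_left, add_zero]
      linarith [(abs_le.1 (abs_snd_add_inner_le hb z)).1]

theorem scaled_second_difference_integral_nonneg {s w : ℝ} (hs : 0 < s) (hs1 : s < 1)
    (hw : 0 < w) :
    0 ≤ ∫ t in Ioi (0 : ℝ),
      (max (w + t) 0 ^ s + max (w - t) 0 ^ s - 2 * w ^ s) * t ^ (-(1 + 2 * s)) := by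
  have h := integral_comp_mul_left_Ioi (fun t : ℝ =>
    (max (w + t) 0 ^ s + max (w - t) 0 ^ s - 2 * w ^ s) * t ^ (-(1 + 2 * s))) 0 hw
  rw [mul_zero, smul_eq_mul] at h
  have hpos : 0 ≤ ∫ x in Ioi (0 : ℝ), (max (w + w * x) 0 ^ s + max (w - w * x) 0 ^ s - 2 * w ^ s) *
      (w * x) ^ (-(1 + 2 * s)) := by
    have e : ∀ x ∈ Ioi (0 : ℝ), (max (w + w * x) 0 ^ s + max (w - w * x) 0 ^ s - 2 * w ^ s) *
        (w * x) ^ (-(1 + 2 * s)) = (w ^ s * w ^ (-(1 + 2 * s))) *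
        ((max (1 + x) 0 ^ s + max (1 - x) 0 ^ s - 2) * x ^ (-(1 + 2 * s))) := by
      intro x (hx : 0 < x)
      have e1 : max (w + w * x) 0 = w * max (1 + x) 0 := by
        rw [mul_max_of_nonneg _ _ hw.le]; ring_nf
      have e2 : max (w - w * x) 0 = w * max (1 - x) 0 := by
        rw [mul_max_of_nonneg _ _ hw.le]; ring_nf
      rw [e1, e2, Real.mul_rpow hw.le (le_max_right _ _), Real.mul_rpow hw.le (le_max_right _ _),
        Real.mul_rpow hw.le hx.le]
      ring
    rw [setIntegral_congr_fun measurableSet_Ioi e, integral_const_mul]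
    exact mul_nonneg (by positivity) (second_difference_integral_nonneg hs hs1)
  rw [h] at hpos
  exact (mul_nonneg_iff_of_pos_left (by positivity)).1 hpos

/-- The kernel integrated over an oblique hyperplane at height `t` is a multiple of
`|t|^{-1-α}`. -/
theorem integral_rieszKernel_oblique (α : ℝ) (b : EuclideanSpace ℝ (Fin m)) {t : ℝ} (ht : t ≠ 0) :
    ∫ v, rieszKernel α (v, t - inner ℝ b v) =
      |t| ^ (-(1 + α)) * ∫ v, rieszKernel α (v, 1 - inner ℝ b v) := by
  have h := Measure.integral_comp_smul (volume : Measure (EuclideanSpace ℝ (Fin m)))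
    (fun v => rieszKernel α (v, t - inner ℝ b v)) t
  have ht' : 0 < |t| := abs_pos.2 ht
  have e : ∀ v : EuclideanSpace ℝ (Fin m), rieszKernel α (t • v, t - inner ℝ b (t • v)) =
      |t| ^ (-((m : ℝ) + 1 + α)) * rieszKernel α (v, 1 - inner ℝ b v) := by
    intro v
    rw [← rieszKernel_smul]
    congr 1
    ext1
    · rfl
    · simp [inner_smul_right, mul_sub]
  simp only [e, finrank_euclideanSpace_fin, smul_eq_mul] at h
  rw [integral_const_mul, abs_inv, abs_pow] at h
  have hm : |t| ^ (-(1 + α)) = |t| ^ m * |t| ^ (-((m : ℝ) + 1 + α)) := by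
    rw [← Real.rpow_natCast, ← Real.rpow_add ht']; congr 1; ring
  rw [hm, mul_assoc, h]
  field_simp

theorem measurePreserving_shear (b : EuclideanSpace ℝ (Fin m)) :
    MeasurePreserving (fun z : EuclideanSpace ℝ (Fin m) × ℝ => (z.1, z.2 - inner ℝ b z.1))
      volume volume := by
  refine MeasurePreserving.skew_product (f := fun v : EuclideanSpace ℝ (Fin m) => v)
    (g := fun v (t : ℝ) => t - inner ℝ b v) (MeasurePreserving.id _) ?_ ?_
  · unfold Function.uncurry
    fun_prop
  · exact Eventually.of_forall fun v => (measurePreserving_sub_right volume _).map_eq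

theorem integral_secondDiff_halfSpacePow_nonneg {s w : ℝ} (hs : 0 < s) (hs1 : s < 1) (hw : 0 < w)
    {b : EuclideanSpace ℝ (Fin m)} (hb : ‖b‖ ≤ 1) :
    0 ≤ ∫ z, secondDiff (halfSpacePow s w b) z * rieszKernel (2 * s) z := by
  have hP := isPowerLike_halfSpacePow hs hw hb
  have hint := hP.integrable_secondDiff (α := 2 * s) hs (by linarith) (by linarith) hw
  have hS := measurePreserving_shear b
  set G : ℝ → ℝ := fun t => max (w + t) 0 ^ s + max (w - t) 0 ^ s - 2 * w ^ s with hG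
  have hG' : ∀ z, secondDiff (halfSpacePow s w b) z = G (z.2 + inner ℝ b z.1) := by
    intro z
    have : w + ((-z).2 + inner ℝ b (-z).1) = w - (z.2 + inner ℝ b z.1) := by simp; ring
    rw [secondDiff, hP.apply_zero, halfSpacePow, halfSpacePow, this]
  have hcomp := hS.integrable_comp_of_integrable hint
  have hmap : ∫ z, secondDiff (halfSpacePow s w b) z * rieszKernel (2 * s) z =
      ∫ z : EuclideanSpace ℝ (Fin m) × ℝ, G z.2 * rieszKernel (2 * s) (z.1, z.2 - inner ℝ b z.1) := by
    conv_lhs => rw [← hS.map_eq]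
    rw [integral_map hS.measurable.aemeasurable (by rw [hS.map_eq]; exact hint.1)]
    simp only [hG', sub_add_cancel]
  have hcomp' : Integrable (fun z : EuclideanSpace ℝ (Fin m) × ℝ =>
      G z.2 * rieszKernel (2 * s) (z.1, z.2 - inner ℝ b z.1)) := by
    refine hcomp.congr (Eventually.of_forall fun z => ?_)
    simp only [Function.comp, hG', sub_add_cancel]
  rw [hmap, Measure.volume_eq_prod, integral_prod_symm _ hcomp']
  have hinner : (fun t : ℝ => ∫ v, G t * rieszKernel (2 * s) (v, t - inner ℝ b v)) =ᵐ[volume]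
      fun t => (∫ v, rieszKernel (2 * s) (v, 1 - inner ℝ b v)) * (G |t| * |t| ^ (-(1 + 2 * s))) := by
    have h0 : ∀ᵐ t : ℝ, t ≠ 0 := by simp [ae_iff]
    filter_upwards [h0] with t ht
    have hGt : G |t| = G t := by
      rcases abs_choice t with h | h
      · rw [h]
      · rw [h]; simp only [hG, ← sub_eq_add_neg, sub_neg_eq_add]; ring
    rw [integral_const_mul, integral_rieszKernel_oblique _ b ht, hGt]
    ring
  rw [integral_congr_ae hinner, integral_const_mul,
    integral_comp_abs (f := fun t => G t * t ^ (-(1 + 2 * s)))]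
  exact mul_nonneg (integral_nonneg fun v => rieszKernel_nonneg _ _)
    (mul_nonneg (by norm_num) (scaled_second_difference_integral_nonneg hs hs1 hw))

end HalfSpace

/-- The vertical distance from `y` to the upper half of the sphere of radius `r`. -/
noncomputable def sphereGap {m : ℕ} (r : ℝ) (y : EuclideanSpace ℝ (Fin m) × ℝ) : ℝ :=
  y.2 - Real.sqrt (r ^ 2 - ‖y.1‖ ^ 2)

section Geometry

/-- First-order expansion of the hemisphere graph function with a one-sided quadratic error. -/
theorem sqrt_sub_norm_sq_expansion {m : ℕ} {r : ℝ} (hr : 0 < r)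
    {v e : EuclideanSpace ℝ (Fin m)} (hv : ‖v‖ < r / 4) (hve : ‖v + e‖ < r / 2) :
    |Real.sqrt (r ^ 2 - ‖v‖ ^ 2) - Real.sqrt (r ^ 2 - ‖v + e‖ ^ 2)| ≤ ‖e‖ ∧
    0 ≤ Real.sqrt (r ^ 2 - ‖v‖ ^ 2) - Real.sqrt (r ^ 2 - ‖v + e‖ ^ 2) -
      inner ℝ ((Real.sqrt (r ^ 2 - ‖v‖ ^ 2))⁻¹ • v) e ∧
    Real.sqrt (r ^ 2 - ‖v‖ ^ 2) * (Real.sqrt (r ^ 2 - ‖v‖ ^ 2) - Real.sqrt (r ^ 2 - ‖v + e‖ ^ 2) -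
      inner ℝ ((Real.sqrt (r ^ 2 - ‖v‖ ^ 2))⁻¹ • v) e) ≤ ‖e‖ ^ 2 := by
  have hv0 := norm_nonneg v
  have hve0 := norm_nonneg (v + e)
  have he0 := norm_nonneg e
  set M := Real.sqrt (r ^ 2 - ‖v‖ ^ 2) with hM
  set A := Real.sqrt (r ^ 2 - ‖v + e‖ ^ 2) with hA
  have hM2 : M ^ 2 = r ^ 2 - ‖v‖ ^ 2 := Real.sq_sqrt (by nlinarith)
  have hA2 : A ^ 2 = r ^ 2 - ‖v + e‖ ^ 2 := Real.sq_sqrt (by nlinarith)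
  have hA0 : 0 ≤ A := Real.sqrt_nonneg _
  have hM9 : 9 / 10 * r ≤ M := Real.le_sqrt_of_sq_le (by nlinarith)
  have hM0 : 0 < M := by linarith
  have hexp : ‖v + e‖ ^ 2 = ‖v‖ ^ 2 + 2 * inner ℝ v e + ‖e‖ ^ 2 := norm_add_sq_real v e
  have h1 : |M - A| ≤ ‖e‖ := by
    have hn : |‖v + e‖ - ‖v‖| ≤ ‖e‖ := by
      have := abs_norm_sub_norm_le (v + e) v
      rwa [add_sub_cancel_left] at this
    have e1 : (M - A) * (M + A) = (‖v + e‖ - ‖v‖) * (‖v + e‖ + ‖v‖) := by nlinarith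
    have e2 : |M - A| * (M + A) = |‖v + e‖ - ‖v‖| * (‖v + e‖ + ‖v‖) := by
      have a1 : |M - A| * (M + A) = |(M - A) * (M + A)| := by
        rw [abs_mul, abs_of_nonneg (by positivity : 0 ≤ M + A)]
      rw [a1, e1, abs_mul, abs_of_nonneg (by positivity : 0 ≤ ‖v + e‖ + ‖v‖)]
    have e3 : |M - A| * (M + A) ≤ ‖e‖ * (M + A) := by
      rw [e2]
      exact mul_le_mul hn (by linarith) (by positivity) he0
    exact le_of_mul_le_mul_right e3 (by linarith)
  have hQ : M * (M - A - inner ℝ (M⁻¹ • v) e) = ((M - A) ^ 2 + ‖e‖ ^ 2) / 2 := by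
    rw [real_inner_smul_left]
    have : M * (M - A - M⁻¹ * inner ℝ v e) = M ^ 2 - M * A - inner ℝ v e := by field_simp
    rw [this]
    nlinarith
  refine ⟨h1, ?_, ?_⟩
  · have : 0 ≤ M * (M - A - inner ℝ (M⁻¹ • v) e) := by rw [hQ]; positivity
    exact (mul_nonneg_iff_of_pos_left hM0).1 this
  · rw [hQ]
    nlinarith [sq_abs (M - A), abs_nonneg (M - A)]

variable {m : ℕ}

theorem sphereGap_pos_iff {r : ℝ} {y : EuclideanSpace ℝ (Fin m) × ℝ} (hr : 0 ≤ r)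
    (hy : 0 < y.2) : 0 < sphereGap r y ↔ r < enorm' y := by
  rw [sphereGap, sub_pos, Real.sqrt_lt' hy, enorm', Real.lt_sqrt hr]
  constructor <;> intro h <;> linarith

/-- A point just above the upper half of the sphere of radius `r`, away from the equator. -/
structure IsNearSphere (r : ℝ) (x : EuclideanSpace ℝ (Fin m) × ℝ) : Prop where
  radius_pos : 0 < r
  snd_pos : 0 < x.2
  lt_norm : r < enorm' x
  norm_lt : enorm' x < r + r / 16
  fst_lt : ‖x.1‖ < r / 4

namespace IsNearSphere

variable {r : ℝ} {x : EuclideanSpace ℝ (Fin m) × ℝ}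

theorem gap_pos (h : IsNearSphere r x) : 0 < sphereGap r x :=
  (sphereGap_pos_iff h.radius_pos.le h.snd_pos).2 h.lt_norm

theorem le_sqrt (h : IsNearSphere r x) : 9 / 10 * r ≤ Real.sqrt (r ^ 2 - ‖x.1‖ ^ 2) :=
  Real.le_sqrt_of_sq_le (by nlinarith [h.fst_lt, h.radius_pos, norm_nonneg x.1])

theorem gap_le_of_norm_lt (h : IsNearSphere r x) {δ : ℝ} (hδ0 : 0 < δ) (hδ : δ ≤ r / 16)
    (hx : enorm' x < r + δ) : sphereGap r x ≤ 2 * δ := by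
  have hr := h.radius_pos
  have hM := h.le_sqrt
  have hM2 : Real.sqrt (r ^ 2 - ‖x.1‖ ^ 2) ^ 2 = r ^ 2 - ‖x.1‖ ^ 2 :=
    Real.sq_sqrt (by nlinarith [h.fst_lt, norm_nonneg x.1])
  have hg := h.gap_pos
  have hsq := enorm'_sq x
  have hsq' : enorm' x ^ 2 < (r + δ) ^ 2 := by
    have := enorm'_nonneg x
    gcongr
  unfold sphereGap at hg ⊢
  set M := Real.sqrt (r ^ 2 - ‖x.1‖ ^ 2)
  by_contra! hc
  nlinarith

theorem gap_le (h : IsNearSphere r x) : sphereGap r x ≤ r / 8 := by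
  have := h.gap_le_of_norm_lt (δ := r / 16) (by linarith [h.radius_pos]) le_rfl h.norm_lt
  linarith

/-- The slope of the tangent plane of the sphere below `x`. -/
noncomputable def slope (r : ℝ) (x : EuclideanSpace ℝ (Fin m) × ℝ) : EuclideanSpace ℝ (Fin m) :=
  (Real.sqrt (r ^ 2 - ‖x.1‖ ^ 2))⁻¹ • x.1

theorem norm_slope_le (h : IsNearSphere r x) : ‖slope r x‖ ≤ 1 := by
  have hM := h.le_sqrt
  have hr := h.radius_pos
  have hv := h.fst_lt
  have hM0 : 0 < Real.sqrt (r ^ 2 - ‖x.1‖ ^ 2) := by linarith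
  rw [slope, norm_smul, Real.norm_of_nonneg (by positivity), inv_mul_eq_div, div_le_one hM0]
  linarith

theorem abs_gap_add_sub_le (h : IsNearSphere r x) {z : EuclideanSpace ℝ (Fin m) × ℝ}
    (hz : ‖(x + z).1‖ < r / 2) :
    |sphereGap r (x + z) - sphereGap r x - z.2| ≤ ‖z.1‖ := by
  have := (sqrt_sub_norm_sq_expansion h.radius_pos h.fst_lt (e := z.1) hz).1
  convert this using 2
  simp only [sphereGap, Prod.fst_add, Prod.snd_add]
  ring

/-- The quadratic error between the distance to the sphere and to its tangent plane. -/
theorem gap_add_expansion (h : IsNearSphere r x) {z : EuclideanSpace ℝ (Fin m) × ℝ}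
    (hz : ‖(x + z).1‖ < r / 2) :
    0 ≤ sphereGap r (x + z) - (sphereGap r x + (z.2 + inner ℝ (slope r x) z.1)) ∧
    sphereGap r x * (sphereGap r (x + z) - (sphereGap r x + (z.2 + inner ℝ (slope r x) z.1))) ≤
      ‖z‖ ^ 2 := by
  obtain ⟨-, h1, h2⟩ := sqrt_sub_norm_sq_expansion h.radius_pos h.fst_lt (e := z.1) hz
  have e : sphereGap r (x + z) - (sphereGap r x + (z.2 + inner ℝ (slope r x) z.1)) =
      Real.sqrt (r ^ 2 - ‖x.1‖ ^ 2) - Real.sqrt (r ^ 2 - ‖x.1 + z.1‖ ^ 2) -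
        inner ℝ ((Real.sqrt (r ^ 2 - ‖x.1‖ ^ 2))⁻¹ • x.1) z.1 := by
    simp only [sphereGap, slope, Prod.fst_add, Prod.snd_add]
    ring
  rw [e]
  refine ⟨h1, le_trans ?_ (h2.trans ?_)⟩
  · exact mul_le_mul_of_nonneg_right (by linarith [h.gap_le, h.le_sqrt, h.radius_pos]) h1
  · have := norm_fst_le_norm z
    gcongr

/-- Near `x` all the constraints defining the shell hold, except possibly `r < |y|`. -/
theorem add_mem_shell (h : IsNearSphere r x) {z : EuclideanSpace ℝ (Fin m) × ℝ}
    (hz : ‖z‖ ≤ r / 8) :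
    enorm' (x + z) < 3 * r / 2 ∧ 0 < (x + z).2 ∧ ‖(x + z).1‖ < r / 2 := by
  have hr := h.radius_pos
  have h1 : ‖x.1 + z.1‖ ≤ ‖x.1‖ + r / 8 :=
    (norm_add_le _ _).trans (by linarith [norm_fst_le_norm z])
  have h2 := abs_le.1 ((abs_snd_le_norm z).trans hz)
  have hv := h.fst_lt
  have hM := h.le_sqrt
  have hg := h.gap_pos
  have hx2 : 9 / 10 * r < x.2 := by unfold sphereGap at hg; linarith
  have hsq := enorm'_sq x
  have hN := h.norm_lt
  have hN0 := enorm'_nonneg x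
  have hx2' : x.2 < r + r / 16 := by nlinarith [sq_nonneg ‖x.1‖]
  refine ⟨?_, ?_, ?_⟩
  · rw [enorm', Real.sqrt_lt' (by linarith)]
    have a1 : ‖(x + z).1‖ ^ 2 ≤ (‖x.1‖ + r / 8) ^ 2 := by
      have : ‖(x + z).1‖ ≤ ‖x.1‖ + r / 8 := h1
      gcongr
    have a2 : (x + z).2 ^ 2 ≤ (x.2 + r / 8) ^ 2 := by
      rw [Prod.snd_add]
      have : 0 ≤ x.2 + z.2 := by linarith
      gcongr
      exact h2.2
    nlinarith
  · rw [Prod.snd_add]; linarith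
  · rw [Prod.fst_add]; linarith

end IsNearSphere

end Geometry

section Hfun

theorem hfun_eq_sphereGap_rpow {d : ℕ} {r p : ℝ} {y : EuclideanSpace ℝ (Fin (d - 1)) × ℝ}
    (h : r < enorm' y ∧ enorm' y < 3 * r / 2 ∧ 0 < y.2 ∧ ‖y.1‖ < r / 2) :
    hfun d r p y = sphereGap r y ^ p := if_pos h

theorem hfun_nonneg {d : ℕ} {r : ℝ} (hr : 0 ≤ r) (p : ℝ)
    (y : EuclideanSpace ℝ (Fin (d - 1)) × ℝ) : 0 ≤ hfun d r p y := by
  by_cases h : r < enorm' y ∧ enorm' y < 3 * r / 2 ∧ 0 < y.2 ∧ ‖y.1‖ < r / 2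
  · rw [hfun_eq_sphereGap_rpow h]
    exact Real.rpow_nonneg ((sphereGap_pos_iff hr h.2.2.1).2 h.1).le _
  · rw [hfun, if_neg h]

theorem measurable_hfun (d : ℕ) (r p : ℝ) : Measurable (hfun d r p) := by
  unfold hfun
  refine Measurable.ite ?_ (by fun_prop) measurable_const
  have h1 : MeasurableSet {y : EuclideanSpace ℝ (Fin (d - 1)) × ℝ | r < enorm' y} :=
    measurableSet_lt measurable_const measurable_enorm'
  have h2 : MeasurableSet {y : EuclideanSpace ℝ (Fin (d - 1)) × ℝ | enorm' y < 3 * r / 2} :=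
    measurableSet_lt measurable_enorm' measurable_const
  have h3 : MeasurableSet {y : EuclideanSpace ℝ (Fin (d - 1)) × ℝ | 0 < y.2} :=
    measurableSet_lt measurable_const measurable_snd
  have h4 : MeasurableSet {y : EuclideanSpace ℝ (Fin (d - 1)) × ℝ | ‖y.1‖ < r / 2} :=
    measurableSet_lt (by fun_prop) measurable_const
  exact h1.inter (h2.inter (h3.inter h4))

theorem hfun_eq_rpow_hfun {d : ℕ} {r : ℝ} (hr : 0 ≤ r) {p s : ℝ} (hs : 0 < s) (hp : 0 < p)
    (y : EuclideanSpace ℝ (Fin (d - 1)) × ℝ) : hfun d r p y = hfun d r s y ^ (p / s) := by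
  by_cases h : r < enorm' y ∧ enorm' y < 3 * r / 2 ∧ 0 < y.2 ∧ ‖y.1‖ < r / 2
  · rw [hfun_eq_sphereGap_rpow h, hfun_eq_sphereGap_rpow h,
      ← Real.rpow_mul ((sphereGap_pos_iff hr h.2.2.1).2 h.1).le]
    congr 1; field_simp
  · rw [hfun, if_neg h, hfun, if_neg h, Real.zero_rpow (by positivity)]

variable {d : ℕ} {r : ℝ} {x : EuclideanSpace ℝ (Fin (d - 1)) × ℝ}

theorem IsNearSphere.hfun_add_eq (h : IsNearSphere r x) {p : ℝ} (hp : 0 < p)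
    {z : EuclideanSpace ℝ (Fin (d - 1)) × ℝ} (hz : ‖z‖ ≤ r / 8) :
    hfun d r p (x + z) = max (sphereGap r (x + z)) 0 ^ p := by
  have hs := h.add_mem_shell hz
  have hiff := sphereGap_pos_iff (y := x + z) h.radius_pos.le hs.2.1
  by_cases hg : 0 < sphereGap r (x + z)
  · rw [hfun_eq_sphereGap_rpow ⟨hiff.1 hg, hs⟩, max_eq_left hg.le]
  · rw [hfun, if_neg (fun hc => hg (hiff.2 hc.1)), max_eq_right (not_lt.1 hg),
      Real.zero_rpow hp.ne']

theorem IsNearSphere.isPowerLike (h : IsNearSphere r x) {p : ℝ} (hp : 0 < p) :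
    IsPowerLike p (sphereGap r x) (fun z => hfun d r p (x + z)) := by
  have hw := h.gap_pos
  have hw8 := h.gap_le
  have hr := h.radius_pos
  refine ⟨(measurable_hfun d r p).comp (by fun_prop), ?_, fun z => hfun_nonneg hr.le p _, ?_, ?_⟩
  · rw [h.hfun_add_eq hp (by simp; positivity), add_zero, max_eq_left hw.le]
  · intro z
    by_cases hz : r < enorm' (x + z) ∧ enorm' (x + z) < 3 * r / 2 ∧ 0 < (x + z).2 ∧
        ‖(x + z).1‖ < r / 2
    · simp only [hfun_eq_sphereGap_rpow hz]
      refine Real.rpow_le_rpow ((sphereGap_pos_iff hr.le hz.2.2.1).2 hz.1).le ?_ hp.le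
      have h1 := (abs_le.1 (h.abs_gap_add_sub_le hz.2.2.2)).2
      have h2 := norm_fst_le_norm z
      have h3 := (abs_le.1 (abs_snd_le_norm z)).2
      linarith
    · simp only [hfun, if_neg hz]
      positivity
  · refine ⟨fun z => z.2 + inner ℝ (IsNearSphere.slope r x) z.1,
      fun z => sphereGap r (x + z) -
        (sphereGap r x + (z.2 + inner ℝ (IsNearSphere.slope r x) z.1)),
      ?_, abs_snd_add_inner_le h.norm_slope_le, ?_⟩
    · intro z; simp; ring
    · intro z hz
      have hz8 : ‖z‖ ≤ r / 8 := by linarith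
      obtain ⟨h1, h2⟩ := h.gap_add_expansion (h.add_mem_shell hz8).2.2
      refine ⟨by rwa [abs_of_nonneg h1], ?_⟩
      have h3 := (abs_le.1 (abs_snd_add_inner_le h.norm_slope_le z)).1
      simp only [h.hfun_add_eq hp hz8]
      rw [max_eq_left (by linarith)]
      congr 1; ring

theorem IsNearSphere.halfSpacePow_le_hfun (h : IsNearSphere r x) {s : ℝ} (hs : 0 < s)
    {z : EuclideanSpace ℝ (Fin (d - 1)) × ℝ} (hz : ‖z‖ ≤ r / 8) :
    halfSpacePow s (sphereGap r x) (IsNearSphere.slope r x) z ≤ hfun d r s (x + z) := by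
  rw [h.hfun_add_eq hs hz, halfSpacePow]
  refine Real.rpow_le_rpow (le_max_right _ _) (max_le_max_right _ ?_) hs.le
  linarith [(h.gap_add_expansion (h.add_mem_shell hz).2.2).1]

/-- The second difference of `h_s` dominates that of the half-space function at the tangent plane
up to a contribution from far away. -/
theorem IsNearSphere.secondDiff_halfSpacePow_le (h : IsNearSphere r x) {s : ℝ} (hs : 0 < s)
    (z : EuclideanSpace ℝ (Fin (d - 1)) × ℝ) :
    secondDiff (halfSpacePow s (sphereGap r x) (IsNearSphere.slope r x)) z ≤
      secondDiff (fun z => hfun d r s (x + z)) z + 2 * (3 * r) ^ s * profile s (‖z‖ / r) := by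
  have hr := h.radius_pos
  have hH := isPowerLike_halfSpacePow hs h.gap_pos h.norm_slope_le
  have hU := h.isPowerLike hs
  have hU0 := hU.apply_zero
  simp only [secondDiff, hH.apply_zero, hU0]
  by_cases hz : ‖z‖ ≤ r / 8
  · have h1 := h.halfSpacePow_le_hfun hs hz
    have h2 := h.halfSpacePow_le_hfun hs (z := -z) (by rwa [norm_neg])
    have h3 := profile_nonneg s (τ := ‖z‖ / r) (by positivity)
    have h4 : 0 ≤ 2 * (3 * r) ^ s * profile s (‖z‖ / r) := by positivity
    linarith
  · push Not at hz
    have h1 := hH.le z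
    have h2 := hH.le (-z)
    rw [norm_neg] at h2
    have h3 := hU.nonneg z
    have h4 := hU.nonneg (-z)
    have hτ : 1 / 8 < ‖z‖ / r := by rw [lt_div_iff₀ hr]; linarith
    have h5 : (sphereGap r x + 2 * ‖z‖) ^ s ≤ (3 * r) ^ s * (‖z‖ / r) ^ s := by
      rw [← Real.mul_rpow (by positivity) (by positivity)]
      refine Real.rpow_le_rpow (by linarith [h.gap_pos, norm_nonneg z]) ?_ hs.le
      have e : 3 * r * (‖z‖ / r) = 3 * ‖z‖ := by field_simp
      rw [e]
      linarith [h.gap_le]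
    rw [profile, if_neg (not_le.2 hτ)]
    nlinarith

theorem IsNearSphere.integral_secondDiff_ge (h : IsNearSphere r x) {s : ℝ} (hs : 0 < s)
    (hs1 : s < 1) :
    -(2 * (3 * r) ^ s * ∫ z : EuclideanSpace ℝ (Fin (d - 1)) × ℝ,
      profile s (‖z‖ / r) * rieszKernel (2 * s) z) ≤
      ∫ z, secondDiff (fun z => hfun d r s (x + z)) z * rieszKernel (2 * s) z := by
  have hw := h.gap_pos
  have hnn := integral_secondDiff_halfSpacePow_nonneg hs hs1 hw h.norm_slope_le
  have hiH := (isPowerLike_halfSpacePow hs hw h.norm_slope_le).integrable_secondDiff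
    (α := 2 * s) hs (by linarith) (by linarith) hw
  have hiU := (h.isPowerLike hs).integrable_secondDiff (α := 2 * s) hs (by linarith)
    (by linarith) hw
  have hiP := (integral_scaled_profile (m := d - 1) (p := s) (α := 2 * s) (by linarith)
    (by linarith) (by linarith) h.radius_pos).1
  have hmono := integral_mono hiH (hiU.add (hiP.const_mul (2 * (3 * r) ^ s))) fun z => by
    have h1 := mul_le_mul_of_nonneg_right (h.secondDiff_halfSpacePow_le hs z)
      (rieszKernel_nonneg (2 * s) z)
    simp only [Pi.add_apply]
    linarith
  simp only [Pi.add_apply] at hmono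
  rw [integral_add hiU (hiP.const_mul _), integral_const_mul] at hmono
  linarith

theorem IsNearSphere.hfun_add_eq_zero (h : IsNearSphere r x) (p : ℝ)
    {z : EuclideanSpace ℝ (Fin (d - 1)) × ℝ}
    (hz : z ∈ Metric.ball (0, -(4 * sphereGap r x)) (sphereGap r x)) :
    hfun d r p (x + z) = 0 := by
  refine if_neg fun hc => ?_
  have hg := (sphereGap_pos_iff h.radius_pos.le hc.2.2.1).2 hc.1
  have h1 := (abs_le.1 (h.abs_gap_add_sub_le hc.2.2.2)).2
  rw [mem_ball_iff_norm] at hz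
  have h2 := (norm_fst_le_norm _).trans_lt hz
  have h3 := (abs_lt.1 ((abs_snd_le_norm _).trans_lt hz)).2
  simp only [Prod.fst_sub, sub_zero, Prod.snd_sub, sub_neg_eq_add] at h2 h3
  linarith [h.gap_pos]

/-- Bernoulli's inequality for second differences: raising `h_s` to a power `q > 1` improves the
second difference where `h_s` vanishes. -/
theorem IsNearSphere.secondDiff_hfun_ge (h : IsNearSphere r x) {p s : ℝ} (hs : 0 < s)
    (hsp : s < p) (z : EuclideanSpace ℝ (Fin (d - 1)) × ℝ) :
    (p / s) * sphereGap r x ^ (p - s) * secondDiff (fun z => hfun d r s (x + z)) z +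
      (p / s - 1) * sphereGap r x ^ p * (Metric.ball (0, -(4 * sphereGap r x))
        (sphereGap r x)).indicator 1 z ≤
      secondDiff (fun z => hfun d r p (x + z)) z := by
  have hw := h.gap_pos
  have hp : 0 < p := hs.trans hsp
  have hr := h.radius_pos
  set w := sphereGap r x with hwdef
  have hq : 1 < p / s := by rwa [one_lt_div hs]
  have hws : 0 < w ^ s := by positivity
  have hwps : 0 < w ^ (p - s) := by positivity
  have hwp : 0 < w ^ p := by positivity
  have hU0 := (h.isPowerLike hs).apply_zero
  have hP0 := (h.isPowerLike hp).apply_zero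
  have e1 : w ^ (p - s) * w ^ s = w ^ p := by rw [← Real.rpow_add hw]; congr 1; ring
  have key : ∀ y, (p / s) * w ^ (p - s) * (hfun d r s (x + y) - w ^ s) ≤
      hfun d r p (x + y) - w ^ p := by
    intro y
    have hn := hfun_nonneg hr.le s (x + y)
    have hB := one_add_mul_self_le_rpow_one_add (s := hfun d r s (x + y) / w ^ s - 1)
      (by linarith [div_nonneg hn hws.le]) hq.le
    rw [add_sub_cancel, Real.div_rpow hn hws.le, ← hfun_eq_rpow_hfun hr.le hs hp,
      ← Real.rpow_mul hw.le, mul_div_cancel₀ p hs.ne'] at hB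
    have hB' := mul_le_mul_of_nonneg_left hB hwp.le
    rw [mul_div_cancel₀ _ hwp.ne'] at hB'
    have e2 : w ^ p * (1 + p / s * (hfun d r s (x + y) / w ^ s - 1)) =
        w ^ p + (p / s) * w ^ (p - s) * (hfun d r s (x + y) - w ^ s) := by
      rw [← e1]; field_simp
    linarith
  have k1 := key z
  have k2 := key (-z)
  simp only [secondDiff, hU0, hP0]
  by_cases hz : z ∈ Metric.ball (0, -(4 * w)) w
  · rw [indicator_of_mem hz, Pi.one_apply]
    have z1 := h.hfun_add_eq_zero s hz
    have z2 := h.hfun_add_eq_zero p hz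
    rw [z1] at k1 ⊢
    rw [z2]
    have e3 : (p / s) * w ^ (p - s) * w ^ s = p / s * w ^ p := by rw [mul_assoc, e1]
    nlinarith
  · rw [indicator_of_notMem hz]
    linarith

/-- The key lower bound for the fractional Laplacian of `h_p`. -/
theorem IsNearSphere.integral_secondDiff_hfun_ge (h : IsNearSphere r x) {p s : ℝ} (hs : 0 < s)
    (hs1 : s < 1) (hsp : s < p) (hp : p < 2 * s) :
    (p / s) * sphereGap r x ^ (p - s) *
        (∫ z, secondDiff (fun z => hfun d r s (x + z)) z * rieszKernel (2 * s) z) +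
      (p / s - 1) * ((10 : ℝ) ^ (-(((d - 1 : ℕ) : ℝ) + 1 + 2 * s)) *
        (volume : Measure (EuclideanSpace ℝ (Fin (d - 1)) × ℝ)).real (Metric.ball 0 1)) *
        sphereGap r x ^ (p - 2 * s) ≤
      ∫ z, secondDiff (fun z => hfun d r p (x + z)) z * rieszKernel (2 * s) z := by
  have hw := h.gap_pos
  have hp0 : 0 < p := hs.trans hsp
  have hq : 1 < p / s := by rwa [one_lt_div hs]
  have hiS := (h.isPowerLike hs).integrable_secondDiff (α := 2 * s) hs (by linarith)
    (by linarith) hw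
  have hiP := (h.isPowerLike hp0).integrable_secondDiff (α := 2 * s) hp0 hp (by linarith) hw
  have hpt := h.secondDiff_hfun_ge hs hsp
  set w := sphereGap r x with hwdef
  set B : Set (EuclideanSpace ℝ (Fin (d - 1)) × ℝ) := Metric.ball (0, -(4 * w)) w with hB
  set κ : ℝ := ((d - 1 : ℕ) : ℝ) + 1 + 2 * s with hκ
  have hκ0 : 0 < κ := by positivity
  have hiB : Integrable (B.indicator (1 : EuclideanSpace ℝ (Fin (d - 1)) × ℝ → ℝ)) :=
    (integrable_indicator_iff Metric.isOpen_ball.measurableSet).2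
      (integrableOn_const (Metric.isBounded_ball.measure_lt_top.ne))
  have hker : ∀ z, (10 * w) ^ (-κ) * B.indicator 1 z ≤ B.indicator 1 z * rieszKernel (2 * s) z := by
    intro z
    by_cases hz : z ∈ B
    · rw [indicator_of_mem hz, Pi.one_apply, mul_one, one_mul, rieszKernel,
        Real.rpow_neg (by positivity)]
      rw [hB, mem_ball_iff_norm] at hz
      have h3 := abs_lt.1 ((abs_snd_le_norm _).trans_lt hz)
      have h2 := (norm_fst_le_norm _).trans_lt hz
      simp only [Prod.fst_sub, sub_zero, Prod.snd_sub, sub_neg_eq_add] at h2 h3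
      have hne : z ≠ 0 := by rintro rfl; simp at h3; linarith
      have hn : ‖z‖ ≤ 5 * w := by
        rw [Prod.norm_def]
        refine max_le (by linarith) ?_
        rw [Real.norm_eq_abs, abs_le]
        constructor <;> linarith
      have hN := enorm'_le_two_mul_norm z
      have hpos := enorm'_pos hne
      gcongr
      linarith
    · simp [indicator_of_notMem hz]
  have hvol : (volume : Measure (EuclideanSpace ℝ (Fin (d - 1)) × ℝ)).real B =
      w ^ (((d - 1 : ℕ) : ℝ) + 1) *
        (volume : Measure (EuclideanSpace ℝ (Fin (d - 1)) × ℝ)).real (Metric.ball 0 1) := by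
    rw [Measure.real, hB, Measure.addHaar_ball _ _ hw.le, ENNReal.toReal_mul,
      ENNReal.toReal_ofReal (by positivity), finrank_prod_real, ← Real.rpow_natCast, Measure.real]
    push_cast
    rfl
  have hmono := integral_mono ((hiS.const_mul ((p / s) * w ^ (p - s))).add
    (hiB.const_mul ((p / s - 1) * w ^ p * (10 * w) ^ (-κ)))) hiP fun z => by
      have h1 := mul_le_mul_of_nonneg_right (hpt z) (rieszKernel_nonneg (2 * s) z)
      have h2 := mul_le_mul_of_nonneg_left (hker z)
        (show 0 ≤ (p / s - 1) * w ^ p from mul_nonneg (by linarith) (by positivity))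
      simp only [Pi.add_apply]
      linarith
  simp only [Pi.add_apply] at hmono
  rw [integral_add (hiS.const_mul _) (hiB.const_mul _), integral_const_mul, integral_const_mul,
    integral_indicator_one Metric.isOpen_ball.measurableSet, hvol] at hmono
  refine le_trans (le_of_eq ?_) hmono
  congr 1
  have e : w ^ (p - 2 * s) = w ^ p * w ^ (-κ) * w ^ (((d - 1 : ℕ) : ℝ) + 1) := by
    rw [← Real.rpow_add hw, ← Real.rpow_add hw]; congr 1; rw [hκ]; ring
  rw [e, Real.mul_rpow (by norm_num) hw.le]
  ring

end Hfun

theorem fracConst_pos (d : ℕ) {α : ℝ} (hα0 : 0 < α) (hα2 : α < 2) : 0 < fracConst d α := by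
  have h1 : 0 < Real.Gamma (((d : ℝ) + α) / 2) := Real.Gamma_pos_of_pos (by positivity)
  have h2 : 0 < Real.Gamma (1 - α / 2) := Real.Gamma_pos_of_pos (by linarith)
  have := Real.pi_pos
  unfold fracConst
  positivity

theorem pvInt2_eq {d : ℕ} (hd : 1 ≤ d) (α : ℝ) (u : EuclideanSpace ℝ (Fin (d - 1)) × ℝ → ℝ)
    (x : EuclideanSpace ℝ (Fin (d - 1)) × ℝ) (ε : ℝ) :
    pvInt2 d α u x ε = ∫ z in {z : EuclideanSpace ℝ (Fin (d - 1)) × ℝ | ε < enorm' z},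
      (u (x + z) - u (x + 0)) * rieszKernel α z := by
  have hS : MeasurableSet {z : EuclideanSpace ℝ (Fin (d - 1)) × ℝ | ε < enorm' z} :=
    measurableSet_lt measurable_const measurable_enorm'
  have hS' : MeasurableSet {y : EuclideanSpace ℝ (Fin (d - 1)) × ℝ | ε < enorm' (y - x)} :=
    measurableSet_lt measurable_const (measurable_enorm'.comp (by fun_prop))
  rw [pvInt2, ← integral_indicator hS', ← integral_indicator hS,
    ← integral_add_left_eq_self _ x]
  congr 1
  funext z
  have hd' : (((d - 1 : ℕ) : ℝ)) + 1 = d := by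
    rw [Nat.cast_sub hd]; push_cast; ring
  have e1 : x + z - x = z := by abel
  have e2 : x - (x + z) = -z := by abel
  simp only [indicator, mem_ofPred_eq, e1, e2, enorm'_neg, add_zero, rieszKernel, hd',
    div_eq_mul_inv]

/-- For `p ∈ (α/2, α)` there exist `δ ∈ (0, r₁/4]` and constants `C ≥ c > 0` such that
for every `y` with `y_d > 0`, `r₁ < |y| < r₁ + δ`, `|ỹ| < r₁/4`, the principal value
limit defining `Δ^{α/2} h_p(y)` exists and
`c (y_d - √(r₁²-|ỹ|²))^{p-α} ≤ Δ^{α/2} h_p(y) ≤ C (y_d - √(r₁²-|ỹ|²))^{p-α}`. -/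
theorem statement5 (d : ℕ) (hd : 1 ≤ d) (α : ℝ) (hα : α ∈ Set.Ioo (0 : ℝ) 2)
    (r1 : ℝ) (hr1 : r1 ∈ Set.Ioc (0 : ℝ) (1 / 2)) (p : ℝ) (hp : p ∈ Set.Ioo (α / 2) α) :
    ∃ δ ∈ Set.Ioc (0 : ℝ) (r1 / 4), ∃ c C : ℝ, 0 < c ∧ c ≤ C ∧
      ∀ y : EuclideanSpace ℝ (Fin (d - 1)) × ℝ,
        0 < y.2 → r1 < enorm' y → enorm' y < r1 + δ → ‖y.1‖ < r1 / 4 →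
        ∃ L : ℝ,
          Filter.Tendsto (pvInt2 d α (hfun d r1 p) y)
            (nhdsWithin 0 (Set.Ioi 0)) (nhds L) ∧
          c * (y.2 - Real.sqrt (r1 ^ 2 - ‖y.1‖ ^ 2)) ^ (p - α) ≤ fracConst d α * L ∧
          fracConst d α * L ≤ C * (y.2 - Real.sqrt (r1 ^ 2 - ‖y.1‖ ^ 2)) ^ (p - α) := by
  obtain ⟨hα0, hα2⟩ := hα
  obtain ⟨hr, hr2⟩ := hr1
  obtain ⟨hsp, hpα⟩ := hp
  obtain ⟨s, rfl⟩ : ∃ s, α = 2 * s := ⟨α / 2, by ring⟩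
  have hs : 0 < s := by linarith
  have hs1 : s < 1 := by linarith
  replace hsp : s < p := by linarith
  have hp0 : 0 < p := hs.trans hsp
  have hq : 1 < p / s := by rwa [one_lt_div hs]
  set K₁ : ℝ := 2 * (3 * r1) ^ s * ∫ z : EuclideanSpace ℝ (Fin (d - 1)) × ℝ,
    profile s (‖z‖ / r1) * rieszKernel (2 * s) z with hK₁
  have hK₁0 : 0 ≤ K₁ := mul_nonneg (by positivity) (integral_nonneg fun z =>
    mul_nonneg (profile_nonneg _ (by positivity)) (rieszKernel_nonneg _ _))
  set K₂ : ℝ := (p / s - 1) * ((10 : ℝ) ^ (-(((d - 1 : ℕ) : ℝ) + 1 + 2 * s)) *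
    (volume : Measure (EuclideanSpace ℝ (Fin (d - 1)) × ℝ)).real (Metric.ball 0 1)) with hK₂
  have hK₂0 : 0 < K₂ := by
    have : 0 < (volume : Measure (EuclideanSpace ℝ (Fin (d - 1)) × ℝ)).real (Metric.ball 0 1) :=
      ENNReal.toReal_pos (Metric.measure_ball_pos _ _ one_pos).ne'
        Metric.isBounded_ball.measure_lt_top.ne
    have h1 : 0 < p / s - 1 := by linarith
    positivity
  set K₃ : ℝ := 400 * ∫ z : EuclideanSpace ℝ (Fin (d - 1)) × ℝ,
    profile p ‖z‖ * (‖z‖ ^ (((d - 1 : ℕ) : ℝ) + 1 + 2 * s))⁻¹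
  have hA := fracConst_pos d hα0 hα2
  set A := fracConst d (2 * s)
  set ρ : ℝ := (K₂ / (2 * (p / s * (K₁ + 1)))) ^ s⁻¹ with hρ
  have hρ0 : 0 < ρ := by positivity
  have hρs : p / s * K₁ * ρ ^ s ≤ K₂ / 2 := by
    rw [hρ, ← Real.rpow_mul (by positivity), inv_mul_cancel₀ hs.ne', Real.rpow_one]
    have h1 : p / s * K₁ * (K₂ / (2 * (p / s * (K₁ + 1)))) = K₂ / 2 * (K₁ / (K₁ + 1)) := by
      field_simp
    rw [h1]
    have h2 : K₁ / (K₁ + 1) ≤ 1 := by rw [div_le_one (by positivity)]; linarith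
    nlinarith
  refine ⟨min (r1 / 16) (ρ / 2), ⟨by positivity, (min_le_left _ _).trans (by linarith)⟩,
    A * (1 / 2 * (K₂ / 2)), max (A * (1 / 2 * (K₂ / 2))) (A * (1 / 2 * K₃)), by positivity,
    le_max_left _ _, ?_⟩
  intro x hx0 hxr hxδ hx1
  have hδ1 : min (r1 / 16) (ρ / 2) ≤ r1 / 16 := min_le_left _ _
  have h : IsNearSphere r1 x := ⟨hr, hx0, hxr, by linarith, hx1⟩
  have hw := h.gap_pos
  have hwρ : sphereGap r1 x ≤ ρ := by
    have := h.gap_le_of_norm_lt (by positivity) hδ1 hxδ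
    linarith [min_le_right (r1 / 16) (ρ / 2)]
  have hU := h.isPowerLike hp0
  refine ⟨1 / 2 * ∫ z, secondDiff (fun z => hfun d r1 p (x + z)) z * rieszKernel (2 * s) z,
    ?_, ?_, ?_⟩
  · rw [show pvInt2 d (2 * s) (hfun d r1 p) x = _ from funext fun ε => pvInt2_eq hd _ _ _ ε]
    exact hU.tendsto_truncated hp0 hpα hα2 hw
  · have h1 := h.integral_secondDiff_hfun_ge hs hs1 hsp hpα
    have h2 := h.integral_secondDiff_ge hs hs1
    have h3 := mul_le_mul_of_nonneg_left h2
      (show 0 ≤ p / s * sphereGap r1 x ^ (p - s) by positivity)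
    have h4 : sphereGap r1 x ^ s ≤ ρ ^ s := Real.rpow_le_rpow hw.le hwρ hs.le
    have h5 : sphereGap r1 x ^ (p - s) = sphereGap r1 x ^ (p - 2 * s) * sphereGap r1 x ^ s := by
      rw [← Real.rpow_add hw]; congr 1; ring
    have h6 : p / s * K₁ * sphereGap r1 x ^ s ≤ K₂ / 2 :=
      (mul_le_mul_of_nonneg_left h4 (by positivity)).trans hρs
    have h7 : 0 < sphereGap r1 x ^ (p - 2 * s) := by positivity
    have h8 := mul_le_mul_of_nonneg_left h6 h7.le
    change A * (1 / 2 * (K₂ / 2)) * sphereGap r1 x ^ (p - 2 * s) ≤ _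
    rw [mul_assoc]
    refine mul_le_mul_of_nonneg_left ?_ hA.le
    rw [← hK₂] at h1
    rw [← hK₁] at h3
    rw [h5] at h1 h3
    linarith
  · change _ ≤ _ * sphereGap r1 x ^ (p - 2 * s)
    refine le_trans ?_ (mul_le_mul_of_nonneg_right (le_max_right _ _) (by positivity))
    rw [mul_assoc]
    refine mul_le_mul_of_nonneg_left ?_ hA.le
    rw [mul_assoc]
    exact mul_le_mul_of_nonneg_left (hU.integral_secondDiff_le hp0 hpα hα2 hw) (by norm_num)
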